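/- Let T_1 and T_2 be rooted trees of orders n_1 and n_2, with bottleneck matrices M_1 and M_2. Then the bottleneck matrix of the rooted product T_1 ⊠ T_2 is permutationally similar to I_{n_1} ⊗ M_2 + (M_1 − I_{n_1}) ⊗ J_{n_2}, where ⊗ is the Kronecker product and J_{n_2} is the n_2×n_2 all-ones matrix. -/

import Mathlib

open Matrix SimpleGraph
open scoped Kronecker

attribute [local instance 10] Classical.propDecidable

/-- A rooted tree: a tree (connected acyclic simple graph) with a distinguished root. -/
structure RTree (V : Type) where
  G : SimpleGraph V
  isTree : G.IsTree
  root : V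

namespace RTree

variable {V : Type}

/-- `T.pord j i` means `j ⪯ i`: the (unique) path joining `j` to the root contains `i`. -/
def pord (T : RTree V) (j i : V) : Prop :=
  T.G.dist j T.root = T.G.dist j i + T.G.dist i T.root

/-- The path matrix `N`: the `(i,j)` entry is `1` if `j ⪯ i` and `0` otherwise. -/
noncomputable def pathMatrix (T : RTree V) : Matrix V V ℝ :=
  Matrix.of fun i j => if T.pord j i then 1 else 0

/-- The bottleneck matrix `M = NᵀN`: the `(i,j)` entry is the number of vertices lying
simultaneously on the path from `i` to the root and on the path from `j` to the root. -/
noncomputable def bottleneck (T : RTree V) : Matrix V V ℝ :=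
  Matrix.of fun i j => (Nat.card {v : V | T.pord i v ∧ T.pord j v} : ℝ)

/-- The neckbottle matrix `Q = N Nᵀ`. -/
noncomputable def neckbottle [Fintype V] (T : RTree V) : Matrix V V ℝ :=
  T.pathMatrix * T.pathMatrixᵀ

/-- The Perron value of a rooted tree: the largest eigenvalue of its bottleneck matrix. -/
noncomputable def perron [Fintype V] (T : RTree V) : ℝ :=
  sSup {t : ℝ | ∃ w : V → ℝ, w ≠ 0 ∧ T.bottleneck *ᵥ w = t • w}

/-- The degree of a vertex. -/
noncomputable def degree (T : RTree V) (v : V) : ℕ :=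
  Nat.card {u : V | T.G.Adj v u}

/-- The moment `μ(T) = ∑ᵥ dist(v, root) · deg(v)`. -/
noncomputable def moment [Fintype V] (T : RTree V) : ℕ :=
  ∑ v : V, T.G.dist v T.root * T.degree v

/-- The root-transmission `t(T) = ∑ᵥ dist(v, root)`. -/
noncomputable def transmission [Fintype V] (T : RTree V) : ℕ :=
  ∑ v : V, T.G.dist v T.root

end RTree

namespace RTree

variable {V₁ V₂ : Type}

lemma dist_le_one_add {V : Type} {G : SimpleGraph V} (hG : G.Connected) {u v w : V}
    (h : G.Adj u v) : G.dist u w ≤ 1 + G.dist v w := by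
  have h1 := hG.dist_triangle (u := u) (v := v) (w := w)
  have h2 : G.dist u v = 1 := SimpleGraph.dist_eq_one_iff_adj.2 h
  omega

lemma dist_hom_le {V W : Type} {G : SimpleGraph V} {H : SimpleGraph W} (hG : G.Connected)
    (f : G →g H) (u v : V) : H.dist (f u) (f v) ≤ G.dist u v := by
  obtain ⟨p, hp⟩ := hG.exists_walk_length_eq_dist u v
  rw [← hp, ← SimpleGraph.Walk.length_map f p]
  exact SimpleGraph.dist_le _

/-- The distance in the rooted product. -/
noncomputable def prodDist (T₁ : RTree V₁) (T₂ : RTree V₂) (x y : V₁ × V₂) : ℕ :=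
  if x.1 = y.1 then T₂.G.dist x.2 y.2
  else T₂.G.dist x.2 T₂.root + T₁.G.dist x.1 y.1 + T₂.G.dist T₂.root y.2

lemma prodDist_le_length (T₁ : RTree V₁) (T₂ : RTree V₂) (S : RTree (V₁ × V₂))
    (hadj : ∀ (i j : V₁) (a b : V₂), S.G.Adj (i, a) (j, b) ↔
      (i = j ∧ T₂.G.Adj a b) ∨ (T₁.G.Adj i j ∧ a = T₂.root ∧ b = T₂.root))
    (x y : V₁ × V₂) (p : S.G.Walk x y) : prodDist T₁ T₂ x y ≤ p.length := by
  induction p with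
  | nil => simp [prodDist]
  | @cons u v w h p ih =>
    obtain ⟨i, a⟩ := u
    obtain ⟨j, b⟩ := v
    obtain ⟨k, c⟩ := w
    rw [SimpleGraph.Walk.length_cons]
    refine le_trans ?_ (Nat.add_le_add_right ih 1)
    rcases (hadj _ _ _ _).1 h with ⟨rfl, h2⟩ | ⟨h1, rfl, rfl⟩
    · have e1 := dist_le_one_add T₂.isTree.1 (w := c) h2
      have e2 := dist_le_one_add T₂.isTree.1 (w := T₂.root) h2
      simp only [prodDist]
      split_ifs <;> omega
    · have e1 := dist_le_one_add T₁.isTree.1 (w := k) h1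
      have e3 : T₂.G.dist T₂.root T₂.root = 0 := SimpleGraph.dist_self
      have e4 : T₁.G.dist k k = 0 := SimpleGraph.dist_self
      simp only [prodDist]
      split_ifs with q1 q2 q2
      · omega
      · omega
      · subst q2; omega
      · omega

lemma dist_eq_prodDist (T₁ : RTree V₁) (T₂ : RTree V₂) (S : RTree (V₁ × V₂))
    (hadj : ∀ (i j : V₁) (a b : V₂), S.G.Adj (i, a) (j, b) ↔
      (i = j ∧ T₂.G.Adj a b) ∨ (T₁.G.Adj i j ∧ a = T₂.root ∧ b = T₂.root))
    (x y : V₁ × V₂) : S.G.dist x y = prodDist T₁ T₂ x y := by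
  apply le_antisymm
  · have A : ∀ i a b, S.G.dist (i, a) (i, b) ≤ T₂.G.dist a b := fun i a b =>
      dist_hom_le T₂.isTree.1
        (⟨fun a => (i, a), fun h => (hadj _ _ _ _).2 (Or.inl ⟨rfl, h⟩)⟩ : T₂.G →g S.G) a b
    have B : ∀ i j, S.G.dist (i, T₂.root) (j, T₂.root) ≤ T₁.G.dist i j := fun i j =>
      dist_hom_le T₁.isTree.1
        (⟨fun i => (i, T₂.root), fun h => (hadj _ _ _ _).2 (Or.inr ⟨h, rfl, rfl⟩)⟩ :
          T₁.G →g S.G) i j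
    obtain ⟨i, a⟩ := x
    obtain ⟨j, b⟩ := y
    simp only [prodDist]
    split_ifs with h
    · subst h; exact A _ _ _
    · have t1 := S.isTree.1.dist_triangle (u := (i, a)) (v := (i, T₂.root)) (w := (j, b))
      have t2 := S.isTree.1.dist_triangle (u := (i, T₂.root)) (v := (j, T₂.root)) (w := (j, b))
      have := A i a T₂.root
      have := A j T₂.root b
      have := B i j
      omega
  · obtain ⟨p, hp⟩ := S.isTree.1.exists_walk_length_eq_dist x y
    rw [← hp]
    exact prodDist_le_length T₁ T₂ S hadj x y p

lemma pord_prod (T₁ : RTree V₁) (T₂ : RTree V₂) (S : RTree (V₁ × V₂))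
    (hroot : S.root = (T₁.root, T₂.root))
    (hadj : ∀ (i j : V₁) (a b : V₂), S.G.Adj (i, a) (j, b) ↔
      (i = j ∧ T₂.G.Adj a b) ∨ (T₁.G.Adj i j ∧ a = T₂.root ∧ b = T₂.root))
    (i k : V₁) (a c : V₂) :
    S.pord (i, a) (k, c) ↔ (k = i ∧ T₂.pord a c) ∨ (k ≠ i ∧ T₁.pord i k ∧ c = T₂.root) := by
  have R : ∀ i a, S.G.dist (i, a) S.root = T₂.G.dist a T₂.root + T₁.G.dist i T₁.root := by
    intro i a
    rw [dist_eq_prodDist T₁ T₂ S hadj, hroot]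
    simp only [prodDist, SimpleGraph.dist_self]
    split_ifs with h
    · subst h; simp
    · omega
  unfold pord
  rw [R, R, dist_eq_prodDist T₁ T₂ S hadj]
  simp only [prodDist]
  by_cases h : i = k
  · subst h; simp; omega
  · have h' : k ≠ i := fun e => h e.symm
    have z : T₂.G.dist c T₂.root = 0 ↔ c = T₂.root := T₂.isTree.1.dist_eq_zero_iff
    have t := T₁.isTree.1.dist_triangle (u := i) (v := k) (w := T₁.root)
    rw [SimpleGraph.dist_comm (u := T₂.root), if_neg h, ← z]
    simp only [h', false_and, false_or, ne_eq, not_false_eq_true, true_and]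
    omega

lemma pord_self {V : Type} (T : RTree V) (i : V) : T.pord i i := by simp [pord]

lemma pord_root {V : Type} (T : RTree V) (i : V) : T.pord i T.root := by simp [pord]

end RTree

/-- Let `S = T₁ ⊠ T₂` be the rooted product (vertex set `V₁ × V₂`,
with a copy of `T₂` for every vertex of `T₁`, roots of copies joined according to the
edges of `T₁`, rooted at the root of the copy at the root of `T₁`). Then the
bottleneck matrix of `S` is permutationally similar to
`I_{n₁} ⊗ M₂ + (M₁ − I_{n₁}) ⊗ J_{n₂}`. -/
theorem bottleneck_rooted_product {V₁ V₂ : Type} [Fintype V₁] [Fintype V₂]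
    (T₁ : RTree V₁) (T₂ : RTree V₂)
    (S : RTree (V₁ × V₂))
    (hroot : S.root = (T₁.root, T₂.root))
    (hadj : ∀ (i j : V₁) (a b : V₂), S.G.Adj (i, a) (j, b) ↔
      (i = j ∧ T₂.G.Adj a b) ∨ (T₁.G.Adj i j ∧ a = T₂.root ∧ b = T₂.root)) :
    ∃ σ : Equiv.Perm (V₁ × V₂),
      S.bottleneck =
        ((1 : Matrix V₁ V₁ ℝ) ⊗ₖ T₂.bottleneck +
          (T₁.bottleneck - 1) ⊗ₖ Matrix.of (fun _ _ : V₂ => (1 : ℝ))).submatrix σ σ := by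
  refine ⟨1, ?_⟩
  have P := RTree.pord_prod T₁ T₂ S hroot hadj
  ext ⟨i, a⟩ ⟨j, b⟩
  simp only [Matrix.submatrix_apply, Equiv.Perm.coe_one, id, Matrix.add_apply,
    Matrix.kroneckerMap_apply, Matrix.sub_apply, Matrix.of_apply, RTree.bottleneck, mul_one,
    Nat.card_coe_set_eq]
  by_cases h : i = j
  · subst h
    have e : {v : V₁ × V₂ | S.pord (i, a) v ∧ S.pord (i, b) v} =
        (Prod.mk i '' {c | T₂.pord a c ∧ T₂.pord b c}) ∪
        ((fun k => (k, T₂.root)) '' ({k | T₁.pord i k ∧ T₁.pord i k} \ {i})) := by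
      ext ⟨k, c⟩
      simp only [Set.mem_setOf_eq, P, Set.mem_union, Set.mem_image, Prod.mk.injEq, Set.mem_diff,
        Set.mem_singleton_iff]
      grind
    have m : i ∈ {k | T₁.pord i k ∧ T₁.pord i k} := ⟨T₁.pord_self i, T₁.pord_self i⟩
    have hc := Set.ncard_diff_singleton_add_one m (Set.toFinite _)
    rw [e, Set.ncard_union_eq, Set.ncard_image_of_injective, Set.ncard_image_of_injective, ← hc]
    · simp
    · intro x y hxy
      simpa using hxy
    · exact Prod.mk_right_injective i
    · rw [Set.disjoint_left]
      rintro _ ⟨c, _, rfl⟩ ⟨k, hk, hk2⟩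
      simp only [Prod.mk.injEq] at hk2
      exact hk.2 hk2.1
  · have e : {v : V₁ × V₂ | S.pord (i, a) v ∧ S.pord (j, b) v} =
        ((fun k => (k, T₂.root)) '' {k | T₁.pord i k ∧ T₁.pord j k}) := by
      ext ⟨k, c⟩
      simp only [Set.mem_setOf_eq, P, Set.mem_image, Prod.mk.injEq]
      have s1 := T₁.pord_self
      have s2 := T₂.pord_root
      grind
    rw [e, Set.ncard_image_of_injective]
    · simp [Matrix.one_apply_ne h]
    · intro x y hxy
      simpa using hxy
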